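/- Let w ∈ ℝ⁴ with qw ≠ w and q²w ≠ w, and suppose 0 < β < α and 0 < B < C < A. If the angle ϕ between w and q²w with respect to g equals π/2 (i.e. g(w,q²w) = 0), then the angle ϕ₁ between w and q²w with respect to g̃ satisfies cos ϕ₁ = β/α, i.e. g̃(w,q²w)/g̃(w,w) = β/α. -/

import Mathlib

open Matrix

/-- The 4×4 cyclic-shift (circulant) permutation matrix with first row (0,1,0,0). -/
def q : Matrix (Fin 4) (Fin 4) ℝ :=
  !![0,1,0,0; 0,0,1,0; 0,0,0,1; 1,0,0,0]

/-- The symmetric 4×4 circulant matrix with first row (A,B,C,B). -/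
def gMat (A B C : ℝ) : Matrix (Fin 4) (Fin 4) ℝ :=
  !![A,B,C,B; B,A,B,C; C,B,A,B; B,C,B,A]

/-- The bilinear form associated with a 4×4 matrix. -/
def bil (M : Matrix (Fin 4) (Fin 4) ℝ) (w v : Fin 4 → ℝ) : ℝ :=
  w ⬝ᵥ M.mulVec v

lemma bil_add_smul (M N : Matrix (Fin 4) (Fin 4) ℝ) (a b : ℝ) (w v : Fin 4 → ℝ) :
    bil (a • M + b • N) w v = a * bil M w v + b * bil N w v := by
  simp [bil, add_mulVec, smul_mulVec, dotProduct_add, dotProduct_smul]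

lemma bil_mul (M N : Matrix (Fin 4) (Fin 4) ℝ) (w v : Fin 4 → ℝ) :
    bil (M * N) w v = bil M w (N *ᵥ v) := by
  simp [bil, mulVec_mulVec]

lemma q_pow_four : q ^ 4 = 1 := by
  ext i j
  fin_cases i <;> fin_cases j <;> simp [q, pow_succ, mul_apply, Fin.sum_univ_four]

lemma bil_gMat_self (A B C : ℝ) (w : Fin 4 → ℝ) :
    bil (gMat A B C) w w = (A - C) * (w 0 ^ 2 + w 1 ^ 2 + w 2 ^ 2 + w 3 ^ 2) +
      (C - B) * ((w 0 + w 2) ^ 2 + (w 1 + w 3) ^ 2) + B * (w 0 + w 1 + w 2 + w 3) ^ 2 := by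
  simp [bil, gMat, mulVec, dotProduct, Fin.sum_univ_four]
  ring

lemma bil_gMat_self_pos {A B C : ℝ} (hB : 0 < B) (hBC : B < C) (hCA : C < A)
    {w : Fin 4 → ℝ} (hw : w ≠ 0) : 0 < bil (gMat A B C) w w := by
  have hsum : 0 < w 0 ^ 2 + w 1 ^ 2 + w 2 ^ 2 + w 3 ^ 2 := by
    obtain ⟨i, hi⟩ := Function.ne_iff.mp hw
    rw [← Fin.sum_univ_four fun i => w i ^ 2]
    exact Finset.sum_pos' (fun j _ => sq_nonneg (w j))
      ⟨i, Finset.mem_univ i, sq_pos_of_ne_zero hi⟩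
  have hAC : 0 < A - C := sub_pos.mpr hCA
  have hCB : 0 < C - B := sub_pos.mpr hBC
  rw [bil_gMat_self]
  positivity

theorem stmt_10 (A B C α β : ℝ) (hβ : 0 < β) (hβα : β < α)
    (hB : 0 < B) (hBC : B < C) (hCA : C < A)
    (w : Fin 4 → ℝ) (hqw : q.mulVec w ≠ w) (hq2w : (q ^ 2).mulVec w ≠ w)
    (h : bil (gMat A B C) w ((q ^ 2).mulVec w) = 0) :
    bil (α • gMat A B C + β • (gMat A B C * q ^ 2)) w ((q ^ 2).mulVec w) /
        bil (α • gMat A B C + β • (gMat A B C * q ^ 2)) w w = β / α := by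
  have hw : w ≠ 0 := by
    rintro rfl
    exact hqw (mulVec_zero q)
  have hpos := bil_gMat_self_pos hB hBC hCA hw
  have hq : (q ^ 2) *ᵥ ((q ^ 2) *ᵥ w) = w := by
    rw [mulVec_mulVec, ← pow_add, q_pow_four, one_mulVec]
  rw [bil_add_smul, bil_add_smul, bil_mul, bil_mul, hq, h, mul_zero, mul_zero, zero_add, add_zero,
    mul_div_mul_right _ _ hpos.ne']
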